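/- Let L, L_r, L_s, Σ, R, Q be a normed continuous-time Markov game structure, fix t ∈ ℝ and 0 < ε ≤ 1, and let x : L → ℝ satisfy x(l) ∈ [0,1] for all l. Let f : L → ℝ → ℝ solve the Bellman equations on [t−ε, t] with terminal value x and take values in [0,1] on [t−ε,t]. Let p1 be a single ε-net approximation from x. For each l ∈ L_r and τ ∈ [t−ε,t], let a_l^τ ∈ Σ(l) be an action maximizing Σ_{l'} R(l,a,l')·(p1(l',τ) − p1(l,τ)) over a ∈ Σ(l). Let g2 : L → ℝ → ℝ satisfy g2(l,t) = x(l), take values in [0,1] on [t−ε,t], and for every τ ∈ [t−ε,t]: for l ∈ L_r the derivative of g2(l,·) at τ equals −Σ_{l'} Q(l,a_l^τ,l')·g2(l',τ), and for l ∈ L_s it equals −min over a ∈ Σ(l) of Σ_{l'} Q(l,a,l')·g2(l',τ). Then ‖g2(·, t−ε) − f(·, t−ε)‖ ≤ 2·ε³, where ‖·‖ is the sup-norm over locations. -/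

import Mathlib

/-- A normed continuous-time Markov game structure: a finite nonempty set `L` of
locations partitioned into reachability locations (`isReach l = true`) and safety
locations (`isReach l = false`), a finite set `A` of actions with a nonempty set
`enabled l` of enabled actions at each location, and a rate matrix `R` whose rows
(for enabled actions) are probability distributions on `L`. -/
structure NCTMG (L A : Type) [Fintype L] [DecidableEq L] [Fintype A] where
  isReach : L → Bool
  enabled : L → Finset A
  enabled_nonempty : ∀ l, (enabled l).Nonempty
  R : L → A → L → ℝ
  R_nonneg : ∀ l a l', a ∈ enabled l → 0 ≤ R l a l'
  R_sum : ∀ l a, a ∈ enabled l → (∑ l', R l a l') = 1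

namespace NCTMG

variable {L A : Type} [Fintype L] [DecidableEq L] [Fintype A]

/-- The generator `Q(l,a,l') = R(l,a,l') − δ_{l,l'}`. -/
def Q (M : NCTMG L A) (l : L) (a : A) (l' : L) : ℝ :=
  M.R l a l' - (if l = l' then 1 else 0)

/-- `opt_l`: maximum over enabled actions at reachability locations, minimum
over enabled actions at safety locations. -/
noncomputable def opt (M : NCTMG L A) (l : L) (v : A → ℝ) : ℝ :=
  if M.isReach l then (M.enabled l).sup' (M.enabled_nonempty l) v
  else (M.enabled l).inf' (M.enabled_nonempty l) v

/-- `f` solves the Bellman equations on `[t−ε, t]` with terminal value `x`. -/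
def SolvesBellman (M : NCTMG L A) (t ε : ℝ) (x : L → ℝ) (f : L → ℝ → ℝ) : Prop :=
  (∀ l, f l t = x l) ∧
  ∀ l, ∀ τ ∈ Set.Icc (t - ε) t,
    HasDerivAt (f l) (-(M.opt l (fun a => ∑ l', M.Q l a l' * f l' τ))) τ

/-- `p1` is a single `ε`-net approximation from terminal value `x` with chosen
actions `act`: each `act l` is enabled and attains `opt_l` of `∑ Q(l,a,·)·x`,
and `p1(l, t−τ) = x(l) + τ·c_l` on `[0,ε]` where `c_l = ∑ Q(l,act l,·)·x`. -/
def IsSingleNet (M : NCTMG L A) (t ε : ℝ) (x : L → ℝ) (act : L → A)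
    (p1 : L → ℝ → ℝ) : Prop :=
  (∀ l, act l ∈ M.enabled l) ∧
  (∀ l, (∑ l', M.Q l (act l) l' * x l') =
      M.opt l (fun a => ∑ l', M.Q l a l' * x l')) ∧
  (∀ l, ∀ τ ∈ Set.Icc (0 : ℝ) ε,
      p1 l (t - τ) = x l + τ * (∑ l', M.Q l (act l) l' * x l'))

end NCTMG

/-- The sup-norm `‖v‖ = max_{l∈L} |v l|` on functions `L → ℝ`. -/
noncomputable def supNorm {L : Type} [Fintype L] [Nonempty L] (v : L → ℝ) : ℝ :=
  Finset.univ.sup' Finset.univ_nonempty (fun l => |v l|)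


/-- Backward maximum principle for a finite family of functions: if the family is nonpositive at
the right end point and the derivative of a member is nonnegative whenever that member is maximal,
then the family is nonpositive. -/
theorem le_zero_of_deriv_nonneg_at_max {ι : Type*} [Finite ι] {a b : ℝ} {w w' : ι → ℝ → ℝ}
    (hw : ∀ i, ∀ τ ∈ Set.Icc a b, HasDerivAt (w i) (w' i τ) τ)
    (hmax : ∀ i, ∀ τ ∈ Set.Icc a b, (∀ j, w j τ ≤ w i τ) → 0 ≤ w' i τ)
    (hb : ∀ i, w i b ≤ 0) (i : ι) {τ : ℝ} (hτ : τ ∈ Set.Icc a b) : w i τ ≤ 0 := by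
  have : Nonempty ι := ⟨i⟩
  have key : ∀ δ > 0, w i τ ≤ δ * (b - τ) := by
    intro δ hδ
    have hder : ∀ j, ∀ r ∈ Set.Icc a b,
        HasDerivAt (fun r => w j r - δ * (b - r)) (w' j r + δ) r := fun j r hr =>
      ((hw j r hr).sub (((hasDerivAt_id r).const_sub b).const_mul δ)).congr_deriv (by ring)
    have hattain : ∀ j, ∃ r ∈ Set.Icc a b,
        IsMaxOn (fun r => w j r - δ * (b - r)) (Set.Icc a b) r := fun j =>
      isCompact_Icc.exists_isMaxOn ⟨τ, hτ⟩
        fun r hr => (hder j r hr).continuousAt.continuousWithinAt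
    choose r hr hrmax using hattain
    obtain ⟨k, hk⟩ := Finite.exists_max fun j => w j (r j) - δ * (b - r j)
    have hglobal : ∀ j, ∀ u ∈ Set.Icc a b, w j u - δ * (b - u) ≤ w k (r k) - δ * (b - r k) :=
      fun j u hu => (hrmax j hu).trans (hk j)
    have hrk : r k = b := by
      by_contra hne
      have hlt : r k < b := lt_of_le_of_ne (hr k).2 hne
      have hpos : 0 ≤ w' k (r k) :=
        hmax k (r k) (hr k) fun j => by linarith [hglobal j (r k) (hr k)]
      have hseg : segment ℝ (r k) b ⊆ Set.Icc a b :=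
        (convex_Icc a b).segment_subset (hr k) ⟨(hr k).1.trans hlt.le, le_rfl⟩
      have hnonpos := (hrmax k).localize.hasFDerivWithinAt_nonpos
        (hder k (r k) (hr k)).hasFDerivAt.hasFDerivWithinAt
        (sub_mem_posTangentConeAt_of_segment_subset hseg)
      simp only [ContinuousLinearMap.toSpanSingleton_apply, smul_eq_mul] at hnonpos
      nlinarith
    have := hglobal i τ hτ
    rw [hrk] at this
    linarith [hb k]
  refine le_of_forall_pos_le_add fun η hη => ?_
  have hpos : 0 < b - τ + 1 := by linarith [hτ.2]
  refine (key (η / (b - τ + 1)) (by positivity)).trans ?_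
  rw [zero_add, div_mul_eq_mul_div, div_le_iff₀ hpos]
  nlinarith

theorem inf'_le_inf'_add {A : Type*} {s : Finset A} (hs : s.Nonempty) {v w : A → ℝ} {c : ℝ}
    (h : ∀ a ∈ s, v a ≤ w a + c) : s.inf' hs v ≤ s.inf' hs w + c := by
  obtain ⟨a, ha, hw⟩ := s.exists_mem_eq_inf' hs w
  rw [hw]
  exact (Finset.inf'_le v ha).trans (h a ha)

namespace NCTMG

variable {L A : Type} [Fintype L] [DecidableEq L] [Fintype A] (M : NCTMG L A)

theorem sum_Q_mul (l : L) (a : A) (v : L → ℝ) :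
    ∑ l', M.Q l a l' * v l' = ∑ l', M.R l a l' * v l' - v l := by
  simp [Q, sub_mul, Finset.sum_sub_distrib]

variable {M} {l : L} {a : A}

theorem sum_R_mul_sub_const (ha : a ∈ M.enabled l) (v : L → ℝ) (c : ℝ) :
    ∑ l', M.R l a l' * (v l' - c) = ∑ l', M.R l a l' * v l' - c := by
  simp [mul_sub, Finset.sum_sub_distrib, ← Finset.sum_mul, M.R_sum l a ha]

theorem sum_R_mul_le_add (ha : a ∈ M.enabled l) {u v : L → ℝ} {c : ℝ}
    (h : ∀ l', v l' ≤ u l' + c) :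
    ∑ l', M.R l a l' * v l' ≤ ∑ l', M.R l a l' * u l' + c := by
  rw [← sub_le_iff_le_add, ← sum_R_mul_sub_const ha]
  exact Finset.sum_le_sum fun l' _ =>
    mul_le_mul_of_nonneg_left (by linarith [h l']) (M.R_nonneg l a l' ha)

theorem sum_Q_mul_le_add (ha : a ∈ M.enabled l) {u v : L → ℝ} {c : ℝ}
    (h : ∀ l', v l' ≤ u l' + c) :
    ∑ l', M.Q l a l' * v l' ≤ ∑ l', M.Q l a l' * u l' + (c - (v l - u l)) := by
  rw [sum_Q_mul, sum_Q_mul]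
  linarith [sum_R_mul_le_add ha h]

theorem abs_sum_Q_mul_le_one (ha : a ∈ M.enabled l) {v : L → ℝ}
    (hv : ∀ l, v l ∈ Set.Icc (0 : ℝ) 1) : |∑ l', M.Q l a l' * v l'| ≤ 1 := by
  have hle := sum_R_mul_le_add ha (u := 0) (v := v) (c := 1) fun l' => by simpa using (hv l').2
  have hge := sum_R_mul_le_add ha (u := v) (v := 0) (c := 0) fun l' => by simpa using (hv l').1
  simp only [Pi.zero_apply, mul_zero, Finset.sum_const_zero] at hle hge
  rw [sum_Q_mul, abs_le]
  constructor <;> linarith [(hv l).1, (hv l).2]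

theorem exists_opt_eq (M : NCTMG L A) (l : L) (v : A → ℝ) : ∃ a ∈ M.enabled l, M.opt l v = v a := by
  unfold opt
  split_ifs
  · exact Finset.exists_mem_eq_sup' _ v
  · exact Finset.exists_mem_eq_inf' _ v

theorem opt_le_opt_add {v w : A → ℝ} {c : ℝ} (h : ∀ a ∈ M.enabled l, v a ≤ w a + c) :
    M.opt l v ≤ M.opt l w + c := by
  unfold opt
  split_ifs
  · exact Finset.sup'_le _ _ fun a ha => (h a ha).trans (by linarith [Finset.le_sup' w ha])
  · exact inf'_le_inf'_add _ h

/-- Over a backward time `s`, a `[0,1]`-valued solution of the Bellman equations moves by at most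
`s`. -/
theorem SolvesBellman.abs_sub_terminal_le {t ε : ℝ} {x : L → ℝ} {f : L → ℝ → ℝ}
    (hf : M.SolvesBellman t ε x f)
    (hf01 : ∀ l, ∀ τ ∈ Set.Icc (t - ε) t, f l τ ∈ Set.Icc (0 : ℝ) 1)
    (l : L) {τ : ℝ} (hτ : τ ∈ Set.Icc (t - ε) t) : |f l τ - x l| ≤ t - τ := by
  have hopt : ∀ l, ∀ r ∈ Set.Icc (t - ε) t,
      |M.opt l (fun a => ∑ l', M.Q l a l' * f l' r)| ≤ 1 := by
    intro l r hr
    obtain ⟨a, ha, h⟩ := M.exists_opt_eq l (fun a => ∑ l', M.Q l a l' * f l' r)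
    rw [h]
    exact abs_sum_Q_mul_le_one ha fun l => hf01 l r hr
  have hs : ∀ r, HasDerivAt (fun r => t - r) (-1) r := fun r => (hasDerivAt_id r).const_sub t
  have hupper := le_zero_of_deriv_nonneg_at_max
    (fun l r hr => ((hf.2 l r hr).sub_const (x l)).sub (hs r))
    (fun l r hr _ => by linarith [(abs_le.mp (hopt l r hr)).2])
    (fun l => by simp [hf.1 l]) l hτ
  have hlower := le_zero_of_deriv_nonneg_at_max
    (fun l r hr => ((hf.2 l r hr).const_sub (x l)).sub (hs r))
    (fun l r hr _ => by linarith [(abs_le.mp (hopt l r hr)).1])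
    (fun l => by simp [hf.1 l]) l hτ
  simp only [Pi.sub_apply] at hupper hlower
  rw [abs_le]
  constructor <;> linarith

/-- The single net approximation has quadratic local error. -/
theorem SolvesBellman.abs_sub_singleNet_le {t ε : ℝ} {x : L → ℝ} {f p : L → ℝ → ℝ} {act : L → A}
    (hf : M.SolvesBellman t ε x f)
    (hf01 : ∀ l, ∀ τ ∈ Set.Icc (t - ε) t, f l τ ∈ Set.Icc (0 : ℝ) 1)
    (hp : M.IsSingleNet t ε x act p) (l : L) {τ : ℝ} (hτ : τ ∈ Set.Icc (t - ε) t) :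
    |f l τ - p l τ| ≤ (t - τ) ^ 2 := by
  obtain ⟨-, hc, hpeq⟩ := hp
  have hle : ∀ l, ∀ r ∈ Set.Icc (t - ε) t,
      M.opt l (fun a => ∑ l', M.Q l a l' * f l' r) ≤
        M.opt l (fun a => ∑ l', M.Q l a l' * x l') + 2 * (t - r) := by
    refine fun l r hr => opt_le_opt_add fun a ha => ?_
    have hclose := fun l => abs_le.mp (hf.abs_sub_terminal_le hf01 l hr)
    linarith [hclose l, sum_Q_mul_le_add ha (u := x) (v := fun l => f l r) (c := t - r)
      fun l' => by linarith [hclose l']]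
  have hge : ∀ l, ∀ r ∈ Set.Icc (t - ε) t,
      M.opt l (fun a => ∑ l', M.Q l a l' * x l') ≤
        M.opt l (fun a => ∑ l', M.Q l a l' * f l' r) + 2 * (t - r) := by
    refine fun l r hr => opt_le_opt_add fun a ha => ?_
    have hclose := fun l => abs_le.mp (hf.abs_sub_terminal_le hf01 l hr)
    linarith [hclose l, sum_Q_mul_le_add ha (v := x) (u := fun l => f l r) (c := t - r)
      fun l' => by linarith [hclose l']]
  have hs : ∀ r, HasDerivAt (fun r => t - r) (-1) r := fun r => (hasDerivAt_id r).const_sub t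
  have hline : ∀ l r, HasDerivAt
      (fun r => x l + (t - r) * M.opt l (fun a => ∑ l', M.Q l a l' * x l'))
      (-1 * M.opt l (fun a => ∑ l', M.Q l a l' * x l')) r :=
    fun l r => ((hs r).mul_const _).const_add _
  have hupper := le_zero_of_deriv_nonneg_at_max
    (fun l r hr => ((hf.2 l r hr).sub (hline l r)).sub ((hs r).pow 2))
    (fun l r hr _ => by norm_num; linarith [hle l r hr])
    (fun l => by simp [hf.1 l]) l hτ
  have hlower := le_zero_of_deriv_nonneg_at_max
    (fun l r hr => ((hline l r).sub (hf.2 l r hr)).sub ((hs r).pow 2))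
    (fun l r hr _ => by norm_num; linarith [hge l r hr])
    (fun l => by simp [hf.1 l]) l hτ
  simp only [Pi.sub_apply, Pi.pow_apply] at hupper hlower
  have hpτ := hpeq l (t - τ) ⟨by linarith [hτ.2], by linarith [hτ.1]⟩
  rw [sub_sub_cancel, hc] at hpτ
  rw [hpτ, abs_le]
  constructor <;> linarith

/-- An action that is optimal for an approximation `p` of `v` up to `c` is optimal for `v` up to
`2 * c`. -/
theorem sum_Q_mul_le_of_approx {b : A} (ha : a ∈ M.enabled l) (hb : b ∈ M.enabled l)
    {v p : L → ℝ} {c : ℝ} (h : ∀ l, |v l - p l| ≤ c)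
    (hopt : ∑ l', M.R l b l' * (p l' - p l) ≤ ∑ l', M.R l a l' * (p l' - p l)) :
    ∑ l', M.Q l b l' * v l' ≤ ∑ l', M.Q l a l' * v l' + 2 * c := by
  rw [sum_R_mul_sub_const ha, sum_R_mul_sub_const hb] at hopt
  rw [sum_Q_mul, sum_Q_mul]
  have hvp := sum_R_mul_le_add hb (v := v) (u := p) (c := c)
    fun l' => by linarith [(abs_le.mp (h l')).2]
  have hpv := sum_R_mul_le_add ha (v := p) (u := v) (c := c)
    fun l' => by linarith [(abs_le.mp (h l')).1]
  linarith

end NCTMG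

/-- the value `g2` obtained when the reachability player plays,
at each time `τ`, the action chosen by the double ε-net approximation (an
action maximising the `p1`-based Bellman right-hand side at `τ`) against an
optimally playing safety player differs from the true Bellman solution `f` by
at most `2·ε³` at time `t−ε`. -/
theorem double_net_strategy_error {L A : Type} [Fintype L] [DecidableEq L]
    [Nonempty L] [Fintype A] (M : NCTMG L A) (t ε : ℝ) (hε0 : 0 < ε)
    (hε1 : ε ≤ 1)
    (x : L → ℝ) (hx : ∀ l, x l ∈ Set.Icc (0 : ℝ) 1)
    (f : L → ℝ → ℝ) (hf : M.SolvesBellman t ε x f)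
    (hf01 : ∀ l, ∀ τ ∈ Set.Icc (t - ε) t, f l τ ∈ Set.Icc (0 : ℝ) 1)
    (act1 : L → A) (p1 : L → ℝ → ℝ) (hp1 : M.IsSingleNet t ε x act1 p1)
    (act : L → ℝ → A)
    (hact : ∀ l, M.isReach l = true → ∀ τ ∈ Set.Icc (t - ε) t,
      act l τ ∈ M.enabled l ∧
      ∀ a ∈ M.enabled l,
        (∑ l', M.R l a l' * (p1 l' τ - p1 l τ)) ≤
          ∑ l', M.R l (act l τ) l' * (p1 l' τ - p1 l τ))
    (g2 : L → ℝ → ℝ)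
    (hg2t : ∀ l, g2 l t = x l)
    (hg201 : ∀ l, ∀ τ ∈ Set.Icc (t - ε) t, g2 l τ ∈ Set.Icc (0 : ℝ) 1)
    (hg2r : ∀ l, M.isReach l = true → ∀ τ ∈ Set.Icc (t - ε) t,
      HasDerivAt (g2 l) (-(∑ l', M.Q l (act l τ) l' * g2 l' τ)) τ)
    (hg2s : ∀ l, M.isReach l = false → ∀ τ ∈ Set.Icc (t - ε) t,
      HasDerivAt (g2 l)
        (-((M.enabled l).inf' (M.enabled_nonempty l)
            (fun a => ∑ l', M.Q l a l' * g2 l' τ))) τ) :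
    supNorm (fun l => g2 l (t - ε) - f l (t - ε)) ≤ 2 * ε ^ 3 := by
  have hs : ∀ r, HasDerivAt (fun r => t - r) (-1) r := fun r => (hasDerivAt_id r).const_sub t
  have hactg : ∀ l, ∀ τ ∈ Set.Icc (t - ε) t, ∃ d, HasDerivAt (g2 l) (-d) τ ∧
      ((∀ l', f l' τ - g2 l' τ ≤ f l τ - g2 l τ) →
        M.opt l (fun a => ∑ l', M.Q l a l' * f l' τ) ≤ d + 2 * (t - τ) ^ 2) ∧
      ((∀ l', g2 l' τ - f l' τ ≤ g2 l τ - f l τ) →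
        d ≤ M.opt l (fun a => ∑ l', M.Q l a l' * f l' τ)) := by
    intro l τ hτ
    have hfg : (∀ l', f l' τ - g2 l' τ ≤ f l τ - g2 l τ) → ∀ a ∈ M.enabled l,
        ∑ l', M.Q l a l' * f l' τ ≤ ∑ l', M.Q l a l' * g2 l' τ + 0 := fun h a ha => by
      linarith [NCTMG.sum_Q_mul_le_add ha (v := fun l => f l τ) (u := fun l => g2 l τ)
        (c := f l τ - g2 l τ) fun l' => by linarith [h l']]
    have hgf : (∀ l', g2 l' τ - f l' τ ≤ g2 l τ - f l τ) → ∀ a ∈ M.enabled l,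
        ∑ l', M.Q l a l' * g2 l' τ ≤ ∑ l', M.Q l a l' * f l' τ + 0 := fun h a ha => by
      linarith [NCTMG.sum_Q_mul_le_add ha (v := fun l => g2 l τ) (u := fun l => f l τ)
        (c := g2 l τ - f l τ) fun l' => by linarith [h l']]
    cases hl : M.isReach l with
    | true =>
      obtain ⟨ha, hbest⟩ := hact l hl τ hτ
      refine ⟨_, hg2r l hl τ hτ, fun h => ?_, fun h => ?_⟩
      · obtain ⟨b, hb, hbeq⟩ := M.exists_opt_eq l (fun a => ∑ l', M.Q l a l' * f l' τ)
        rw [hbeq]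
        linarith [hfg h _ ha, NCTMG.sum_Q_mul_le_of_approx ha hb
          (fun l => hf.abs_sub_singleNet_le hf01 hp1 l hτ) (hbest b hb)]
      · rw [NCTMG.opt, if_pos hl]
        linarith [hgf h _ ha, Finset.le_sup' (fun a => ∑ l', M.Q l a l' * f l' τ) ha]
    | false =>
      have hopt : ∀ v, M.opt l v = (M.enabled l).inf' (M.enabled_nonempty l) v := fun v => by
        simp [NCTMG.opt, hl]
      refine ⟨_, hg2s l hl τ hτ, fun h => ?_, fun h => ?_⟩
      · rw [hopt]
        linarith [inf'_le_inf'_add (M.enabled_nonempty l) (hfg h), sq_nonneg (t - τ)]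
      · rw [hopt]
        linarith [inf'_le_inf'_add (M.enabled_nonempty l) (hgf h)]
  choose! d hd hdf hdg using hactg
  have hmem : t - ε ∈ Set.Icc (t - ε) t := ⟨le_rfl, by linarith⟩
  refine Finset.sup'_le _ _ fun l _ => ?_
  have hupper := le_zero_of_deriv_nonneg_at_max
    (fun l r hr => (hd l r hr).sub (hf.2 l r hr))
    (fun l r hr h => by linarith [hdg l r hr h])
    (fun l => by simp [hf.1 l, hg2t l]) l hmem
  have hlower := le_zero_of_deriv_nonneg_at_max
    (fun l r hr => ((hf.2 l r hr).sub (hd l r hr)).sub (((hs r).pow 3).const_mul (2 / 3)))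
    (fun l r hr h => by
      have := hdf l r hr fun l' => by simpa using h l'
      norm_num
      linarith)
    (fun l => by simp [hf.1 l, hg2t l]) l hmem
  simp only [Pi.sub_apply, Pi.pow_apply, sub_sub_cancel] at hupper hlower
  have hε3 : 0 < ε ^ 3 := by positivity
  rw [abs_le]
  constructor <;> linarith
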